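/- If σ^0, σ^1, σ^2, σ^3 are hermitean 2×2 complex matrices ((σ^I_{αβ̇})^* = σ^I_{βα̇}), then the quantum metric G_±^{IJ} := (1/Q) Σ ε^{αν} σ^I_{αβ̇} σ̄_±^{Jβ̇γ} ε_{γν} is hermitean: (G_±^{IJ})^* = G_±^{JI} for all I, J ∈ {0,1,2,3}. -/

import Mathlib

noncomputable section

open scoped Matrix

/-- Lower undotted spinor metric `ε_{αβ}` of the two-parameter deformation. -/
def epsLo (q r : ℝ) : Matrix (Fin 2) (Fin 2) ℂ :=
  ((Real.sqrt (1 - r ^ 2) : ℂ))⁻¹ •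
    !![Complex.I * (r : ℂ), -((Real.sqrt q : ℂ))⁻¹; (Real.sqrt q : ℂ), Complex.I * (r : ℂ)]

/-- Upper undotted spinor metric `ε^{αβ}`. -/
def epsUp (q r : ℝ) : Matrix (Fin 2) (Fin 2) ℂ :=
  ((Real.sqrt (1 - r ^ 2) : ℂ))⁻¹ •
    !![Complex.I * (r : ℂ), ((Real.sqrt q : ℂ))⁻¹; -(Real.sqrt q : ℂ), Complex.I * (r : ℂ)]

/-- Lower dotted spinor metric `ε_{α̇β̇}`. -/
def epsLoD (q r : ℝ) : Matrix (Fin 2) (Fin 2) ℂ :=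
  ((Real.sqrt (1 - r ^ 2) : ℂ))⁻¹ •
    !![-(Complex.I * (r : ℂ)), (Real.sqrt q : ℂ); -((Real.sqrt q : ℂ))⁻¹, -(Complex.I * (r : ℂ))]

/-- Upper dotted spinor metric `ε^{α̇β̇}`. -/
def epsUpD (q r : ℝ) : Matrix (Fin 2) (Fin 2) ℂ :=
  ((Real.sqrt (1 - r ^ 2) : ℂ))⁻¹ •
    !![-(Complex.I * (r : ℂ)), -(Real.sqrt q : ℂ); ((Real.sqrt q : ℂ))⁻¹, -(Complex.I * (r : ℂ))]

/-- `Q = (2r + q + q⁻¹)/(1 − r²)`. -/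
def Qval (q r : ℝ) : ℝ := (2 * r + q + q⁻¹) / (1 - r ^ 2)

/-- The R-matrix `R^{αβ}_{γδ} = δ^α_γ δ^β_δ + c · ε^{αβ} ε_{γδ}` (with `c = a^{±1}`). -/
def Rm (q r : ℝ) (c : ℂ) (α β γ δ : Fin 2) : ℂ :=
  (if α = γ then 1 else 0) * (if β = δ then 1 else 0) + c * epsUp q r α β * epsLo q r γ δ

/-- The conjugate `σ̄_±^{α̇β} = a^{±1/2} Σ ε^{α̇λ̇} ε_{ρκ} R^{∓σκ}_{μν} ε^{μλ} ε^{νβ} σ_{σρ̇}`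
of a 2×2 matrix `σ`; `s = true` is the `+` sign, `s = false` the `−` sign. -/
def sbar (q r a : ℝ) (s : Bool) (σ : Matrix (Fin 2) (Fin 2) ℂ) (ad b : Fin 2) : ℂ :=
  (if s then (Real.sqrt a : ℂ) else ((Real.sqrt a : ℂ))⁻¹) *
    ∑ l, ∑ sg, ∑ rh, ∑ ka, ∑ mu, ∑ nu,
      epsUpD q r ad l * epsLo q r rh ka * Rm q r (if s then ((a : ℂ))⁻¹ else (a : ℂ)) sg ka mu nu *
        epsUp q r mu l * epsUp q r nu b * σ sg rh

/-- The quantum Pauli matrices `σ^0, σ^1, σ^2, σ^3`. -/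
def pauli : Fin 4 → Matrix (Fin 2) (Fin 2) ℂ :=
  ![!![1, 0; 0, 1], !![0, 1; 1, 0], !![0, -Complex.I; Complex.I, 0], !![1, 0; 0, -1]]

/-- The metric pairing `G_±^{IJ} = (1/Q) Σ ε^{αν} σ^I_{αβ̇} σ̄_±^{Jβ̇γ} ε_{γν}`. -/
def Gpair (q r a : ℝ) (s : Bool) (σI σJ : Matrix (Fin 2) (Fin 2) ℂ) : ℂ :=
  (1 / (Qval q r : ℂ)) * ∑ al, ∑ nu, ∑ be, ∑ ga,
    epsUp q r al nu * σI al be * sbar q r a s σJ be ga * epsLo q r ga nu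

/-- The quantum Minkowski metric `G_±^{IJ}` as a 4×4 matrix. -/
def GupM (q r a : ℝ) (s : Bool) : Matrix (Fin 4) (Fin 4) ℂ :=
  fun I J => Gpair q r a s (pauli I) (pauli J)

/-- The inverse metric `G_{±IJ}`. -/
def GloM (q r a : ℝ) (s : Bool) : Matrix (Fin 4) (Fin 4) ℂ := (GupM q r a s)⁻¹

/-- The lowered conjugate Pauli matrices `σ̄_L^{α̇β} = Σ_N G_{+LN} σ̄_+^{Nα̇β}`. -/
def sbarL (q r a : ℝ) (L : Fin 4) (ad b : Fin 2) : ℂ :=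
  ∑ N, GloM q r a true L N * sbar q r a true (pauli N) ad b

/-- The quantum Lorentz group generators
`Λ_L^K = (1/Q) Σ ε_{γ̇δ̇} σ̄_L^{δ̇α} M_α^σ σ^K_{σρ̇} M̄_β̇^{ρ̇} ε^{γ̇β̇}`. -/
def Lor {A : Type*} [Ring A] [Algebra ℂ A] (q r a : ℝ)
    (M Mb : Fin 2 → Fin 2 → A) (L K : Fin 4) : A :=
  ∑ ga, ∑ de, ∑ al, ∑ sg, ∑ rh, ∑ be,
    ((1 / (Qval q r : ℂ)) * epsLoD q r ga de * sbarL q r a L de al * pauli K sg rh *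
      epsUpD q r ga be) • (M al sg * Mb be rh)

/-- The Lorentz R-matrices
`𝓡^{±NM}_{LK} = (1/Q²) Σ R^{∓ακ}_{τσ} R^{∓μβ}_{κν} R^{±ρξ}_{δα} R^{±λγ}_{ξμ}
σ^{M β̇}_γ σ^{N λ̇}_ρ σ̄_{Lτ̇}^δ σ̄_{Kν̇}^σ`. -/
def Rlor (q r a : ℝ) (s : Bool) (N M L K : Fin 4) : ℂ :=
  (1 / (Qval q r : ℂ) ^ 2) *
    ∑ al, ∑ be, ∑ ga, ∑ de, ∑ ka, ∑ l, ∑ mu, ∑ nu, ∑ xi, ∑ rh, ∑ sg, ∑ ta,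
      Rm q r (if s then ((a : ℂ))⁻¹ else (a : ℂ)) al ka ta sg *
        Rm q r (if s then ((a : ℂ))⁻¹ else (a : ℂ)) mu be ka nu *
          Rm q r (if s then (a : ℂ) else ((a : ℂ))⁻¹) rh xi de al *
            Rm q r (if s then (a : ℂ) else ((a : ℂ))⁻¹) l ga xi mu *
              (∑ p, epsUpD q r be p * pauli M ga p) *
                (∑ p, epsUpD q r l p * pauli N rh p) *
                  (∑ p, epsLoD q r ta p * sbarL q r a L p de) *
                    (∑ p, epsLoD q r nu p * sbarL q r a K p sg)

end

open scoped Matrix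

lemma epsLo_mul_epsUp {q r : ℝ} (hq : 0 < q) (hr : r ^ 2 < 1) :
    epsLo q r * epsUp q r = 1 := by
  have hp : (Real.sqrt q : ℂ) ≠ 0 := by exact_mod_cast (Real.sqrt_pos.2 hq).ne'
  have hd : (Real.sqrt (1 - r ^ 2) : ℂ) ≠ 0 := by
    exact_mod_cast (Real.sqrt_pos.2 (sub_pos.2 hr)).ne'
  have hs : (Real.sqrt (1 - r ^ 2) : ℂ) ^ 2 = 1 - r ^ 2 := by
    exact_mod_cast Real.sq_sqrt (sub_pos.2 hr).le
  ext i j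
  fin_cases i <;> fin_cases j <;>
    simp [epsLo, epsUp, Matrix.mul_apply, Fin.sum_univ_two] <;> field_simp <;>
    simp [hs] <;> ring

lemma epsUpD_mul_epsUp_transpose {q r : ℝ} (hq : 0 < q) (hr : r ^ 2 < 1) :
    epsUpD q r * (epsUp q r)ᵀ = -1 := by
  have hp : (Real.sqrt q : ℂ) ≠ 0 := by exact_mod_cast (Real.sqrt_pos.2 hq).ne'
  have hd : (Real.sqrt (1 - r ^ 2) : ℂ) ≠ 0 := by
    exact_mod_cast (Real.sqrt_pos.2 (sub_pos.2 hr)).ne'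
  have hs : (Real.sqrt (1 - r ^ 2) : ℂ) ^ 2 = 1 - r ^ 2 := by
    exact_mod_cast Real.sq_sqrt (sub_pos.2 hr).le
  ext i j
  fin_cases i <;> fin_cases j <;>
    simp [epsUpD, epsUp, Matrix.mul_apply, Fin.sum_univ_two] <;> field_simp <;>
    simp [hs] <;> ring

lemma isHermitian_epsLo_mul_epsUp_transpose (q r : ℝ) :
    (epsLo q r * (epsUp q r)ᵀ).IsHermitian := by
  refine Matrix.IsHermitian.ext fun i j => ?_
  simp only [Matrix.mul_apply, Fin.sum_univ_two, Matrix.transpose_apply]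
  fin_cases i <;> fin_cases j <;> simp [epsLo, epsUp] <;> ring

/-- The conjugate in matrix form, before the spinor metrics are contracted. -/
lemma sbar_eq_mul (q r a : ℝ) (s : Bool) (σ : Matrix (Fin 2) (Fin 2) ℂ) :
    Matrix.of (sbar q r a s σ) = (if s then (Real.sqrt a : ℂ) else ((Real.sqrt a : ℂ))⁻¹) •
      (epsUpD q r * (epsUp q r)ᵀ * σ * (epsLo q r * epsUp q r) +
        ((if s then ((a : ℂ))⁻¹ else (a : ℂ)) * (epsLo q r * (epsUp q r)ᵀ * σ).trace) •
          (epsUpD q r * (epsUp q r)ᵀ * (epsLo q r * epsUp q r))) := by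
  ext i j
  simp only [Matrix.of_apply, sbar, Rm, Matrix.smul_apply, Matrix.add_apply, smul_eq_mul]
  congr 1
  generalize epsUpD q r = V
  generalize epsUp q r = U
  generalize epsLo q r = E
  generalize (if s then ((a : ℂ))⁻¹ else (a : ℂ)) = c
  simp [Matrix.mul_apply, Matrix.trace, Fin.sum_univ_two]
  ring

lemma Gpair_eq_trace {q r : ℝ} (hq : 0 < q) (hr : r ^ 2 < 1) (a : ℝ) (s : Bool)
    (σ τ : Matrix (Fin 2) (Fin 2) ℂ) :
    Gpair q r a s σ τ =
      -(1 / (Qval q r : ℂ) * (if s then (Real.sqrt a : ℂ) else ((Real.sqrt a : ℂ))⁻¹)) *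
        ((σ * τ * (epsLo q r * (epsUp q r)ᵀ)).trace +
          (if s then ((a : ℂ))⁻¹ else (a : ℂ)) * (epsLo q r * (epsUp q r)ᵀ * τ).trace *
            (epsLo q r * (epsUp q r)ᵀ * σ).trace) := by
  have key : Gpair q r a s σ τ =
      1 / (Qval q r : ℂ) *
        (σ * Matrix.of (sbar q r a s τ) * (epsLo q r * (epsUp q r)ᵀ)).trace := by
    rw [Gpair]
    congr 1
    simp [Matrix.mul_apply, Matrix.trace, Fin.sum_univ_two]
    ring
  rw [key, sbar_eq_mul, epsLo_mul_epsUp hq hr, epsUpD_mul_epsUp_transpose hq hr,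
    Matrix.trace_mul_comm _ σ]
  simp only [neg_mul, one_mul, mul_one, mul_add, add_mul, mul_neg, smul_neg, Matrix.mul_smul,
    Matrix.smul_mul, Matrix.trace_add, Matrix.trace_neg, Matrix.trace_smul, smul_eq_mul]
  ring

/-- The trace of a product of hermitean matrices is conjugated by reversing the product. -/
lemma star_trace_mul_of_isHermitian {n : Type*} [Fintype n] {A B : Matrix n n ℂ}
    (hA : A.IsHermitian) (hB : B.IsHermitian) : star (A * B).trace = (A * B).trace := by
  rw [← Matrix.trace_conjTranspose, Matrix.conjTranspose_mul, hA.eq, hB.eq, Matrix.trace_mul_comm]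

/-- if `σ^0, σ^1, σ^2, σ^3` are hermitean 2×2 matrices, the quantum
metric `G_±^{IJ}` is hermitean: `(G_±^{IJ})^* = G_±^{JI}`. -/
theorem Gmetric_hermitean (q r : ℝ) (hq : 0 < q) (hr : r ^ 2 < 1)
    (a : ℝ) (ha : 0 < a) (haQ : a + a⁻¹ = Qval q r)
    (σs : Fin 4 → Matrix (Fin 2) (Fin 2) ℂ)
    (hherm : ∀ (I : Fin 4) (α β : Fin 2), starRingEnd ℂ (σs I α β) = σs I β α)
    (s : Bool) :
    ∀ I J : Fin 4,
      starRingEnd ℂ (Gpair q r a s (σs I) (σs J)) = Gpair q r a s (σs J) (σs I) := by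
  intro I J
  have hσ (K : Fin 4) : (σs K).IsHermitian := by
    ext i j
    exact hherm K j i
  have hX := isHermitian_epsLo_mul_epsUp_transpose q r
  rw [Gpair_eq_trace hq hr, Gpair_eq_trace hq hr, starRingEnd_apply]
  generalize epsLo q r * (epsUp q r)ᵀ = X at hX ⊢
  have hIJ : star (σs I * σs J * X).trace = (σs J * σs I * X).trace := by
    rw [← Matrix.trace_conjTranspose, Matrix.conjTranspose_mul, Matrix.conjTranspose_mul,
      hX.eq, (hσ I).eq, (hσ J).eq, Matrix.trace_mul_comm]
  simp only [star_mul', star_add, star_neg, hIJ, star_trace_mul_of_isHermitian hX (hσ _)]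
  rw [mul_right_comm (star _)]
  cases s <;> simp
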